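/- For every positive integer n, cf(n) ≤ 2·⌈n/9⌉; that is, for every n there exists a set of n points in the plane in general position whose largest crossing family has size at most 2·⌈n/9⌉. -/

import Mathlib

/-- A finite set of points in the plane is in *general position* if no three of
its points are collinear. -/
def GenPos (S : Finset (ℝ × ℝ)) : Prop :=
  ∀ p ∈ S, ∀ q ∈ S, ∀ r ∈ S, p ≠ q → p ≠ r → q ≠ r →
    ¬Collinear ℝ ({p, q, r} : Set (ℝ × ℝ))

/-- Two closed segments `pq` and `rs` *cross* if they intersect in exactly one
point, which lies in the interior of both segments. -/
def Crosses (p q r s : ℝ × ℝ) : Prop :=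
  ∃ x : ℝ × ℝ, x ∈ openSegment ℝ p q ∧ x ∈ openSegment ℝ r s ∧
    segment ℝ p q ∩ segment ℝ r s = {x}

/-- `F` is a *crossing family* in `S`: a finite set of segments (given by their
pairs of distinct endpoints, which belong to `S`) that pairwise cross. -/
def IsCrossingFamily (S : Finset (ℝ × ℝ)) (F : Finset ((ℝ × ℝ) × (ℝ × ℝ))) : Prop :=
  (∀ e ∈ F, e.1 ∈ S ∧ e.2 ∈ S ∧ e.1 ≠ e.2) ∧
  (∀ e ∈ F, ∀ f ∈ F, e ≠ f → Crosses e.1 e.2 f.1 f.2)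

/-- `S` contains a `k`-crossing family. -/
def HasCrossingFamily (S : Finset (ℝ × ℝ)) (k : ℕ) : Prop :=
  ∃ F : Finset ((ℝ × ℝ) × (ℝ × ℝ)), IsCrossingFamily S F ∧ F.card = k

/-- `cf S`: the maximum size of a crossing family in `S`. -/
noncomputable def cf (S : Finset (ℝ × ℝ)) : ℕ :=
  sSup {k : ℕ | HasCrossingFamily S k}

/-- `cfNat n`: the minimum of `cf S` over all sets `S` of `n` points in
general position. -/
noncomputable def cfNat (n : ℕ) : ℕ :=
  sInf {m : ℕ | ∃ S : Finset (ℝ × ℝ), S.card = n ∧ GenPos S ∧ cf S = m}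

/-- Twice the signed area of the triangle `pqr`. -/
def orient (p q r : ℝ × ℝ) : ℝ :=
  (q.1 - p.1) * (r.2 - p.2) - (q.2 - p.2) * (r.1 - p.1)

theorem orient_eq_zero_of_collinear {p q r : ℝ × ℝ}
    (h : Collinear ℝ ({p, q, r} : Set (ℝ × ℝ))) : orient p q r = 0 := by
  obtain ⟨v, hv⟩ := (collinear_iff_of_mem (p₀ := p) (by simp)).1 h
  obtain ⟨a, ha⟩ := hv q (by simp)
  obtain ⟨b, hb⟩ := hv r (by simp)
  simp only [orient, ha, hb, vadd_eq_add, Prod.fst_add, Prod.snd_add, Prod.smul_fst,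
    Prod.smul_snd, smul_eq_mul]
  ring

theorem Crosses.swap_left {p q r s : ℝ × ℝ} (h : Crosses p q r s) : Crosses q p r s := by
  simpa only [Crosses, openSegment_symm ℝ p q, segment_symm ℝ p q] using h

theorem Crosses.symm {p q r s : ℝ × ℝ} (h : Crosses p q r s) : Crosses r s p q := by
  obtain ⟨x, hx, hx', hs⟩ := h
  exact ⟨x, hx', hx, by rw [Set.inter_comm, hs]⟩

theorem Crosses.swap_right {p q r s : ℝ × ℝ} (h : Crosses p q r s) : Crosses p q s r :=
  h.symm.swap_left.symm

/-- The line through one of two crossing segments separates the endpoints of the other. -/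
theorem Crosses.exists_orient_add_eq_zero {p q r s : ℝ × ℝ} (h : Crosses p q r s) :
    ∃ a b : ℝ, 0 < a ∧ 0 < b ∧ a * orient p q r + b * orient p q s = 0 := by
  obtain ⟨x, ⟨c, d, _, _, hcd, rfl⟩, ⟨a, b, ha, hb, hab, hx⟩, -⟩ := h
  refine ⟨a, b, ha, hb, ?_⟩
  obtain ⟨h1, h2⟩ := Prod.ext_iff.1 hx
  simp only [Prod.fst_add, Prod.snd_add, Prod.smul_fst, Prod.smul_snd, smul_eq_mul] at h1 h2
  obtain rfl : b = 1 - a := by linarith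
  obtain rfl : d = 1 - c := by linarith
  simp only [orient]
  linear_combination (q.1 - p.1) * h2 - (q.2 - p.2) * h1

/-- If `pq` crosses `rs`, then `q` and `s` lie on the same side of the line `pr`. -/
theorem Crosses.exists_orient_eq {p q r s : ℝ × ℝ} (h : Crosses p q r s) :
    ∃ a b : ℝ, 0 < a ∧ 0 < b ∧ a * orient p r q = b * orient p r s := by
  obtain ⟨x, ⟨c, d, _, hd, hcd, rfl⟩, ⟨a, b, _, hb, hab, hx⟩, -⟩ := h
  refine ⟨d, b, hd, hb, ?_⟩
  obtain ⟨h1, h2⟩ := Prod.ext_iff.1 hx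
  simp only [Prod.fst_add, Prod.snd_add, Prod.smul_fst, Prod.smul_snd, smul_eq_mul] at h1 h2
  obtain rfl : a = 1 - b := by linarith
  obtain rfl : c = 1 - d := by linarith
  simp only [orient]
  linear_combination (r.2 - p.2) * h1 - (r.1 - p.1) * h2

theorem not_crosses_self {p q : ℝ × ℝ} (hpq : p ≠ q) : ¬ Crosses p q p q := by
  rintro ⟨x, -, -, h⟩
  rw [Set.inter_self] at h
  have hp : p ∈ segment ℝ p q := left_mem_segment ℝ p q
  have hq : q ∈ segment ℝ p q := right_mem_segment ℝ p q
  rw [h, Set.mem_singleton_iff] at hp hq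
  exact hpq (hp.trans hq.symm)

theorem GenPos.mono {S T : Finset (ℝ × ℝ)} (hT : GenPos T) (hST : S ⊆ T) : GenPos S :=
  fun p hp q hq r hr => hT p (hST hp) q (hST hq) r (hST hr)

theorem IsCrossingFamily.mono {S T : Finset (ℝ × ℝ)} {F : Finset ((ℝ × ℝ) × (ℝ × ℝ))}
    (hF : IsCrossingFamily S F) (hST : S ⊆ T) : IsCrossingFamily T F :=
  ⟨fun e he => ⟨hST (hF.1 e he).1, hST (hF.1 e he).2.1, (hF.1 e he).2.2⟩, hF.2⟩

/-- `p` and `q` are the endpoints of a segment of `F`, in some order. -/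
def Joins (F : Finset ((ℝ × ℝ) × (ℝ × ℝ))) (p q : ℝ × ℝ) : Prop :=
  (p, q) ∈ F ∨ (q, p) ∈ F

theorem IsCrossingFamily.crosses {S : Finset (ℝ × ℝ)} {F : Finset ((ℝ × ℝ) × (ℝ × ℝ))}
    (hF : IsCrossingFamily S F) {p q r s : ℝ × ℝ} (h : Joins F p q) (h' : Joins F r s)
    (hr : p ≠ r) (hs : p ≠ s) : Crosses p q r s := by
  rcases h with h | h <;> rcases h' with h' | h'
  · exact hF.2 _ h _ h' (by simp [hr])
  · exact (hF.2 _ h _ h' (by simp [hs])).swap_right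
  · exact (hF.2 _ h _ h' (by simp [hs])).swap_left
  · exact (hF.2 _ h _ h' (by simp [hr])).swap_left.swap_right

/-- In a set whose triples have nonzero orientation, distinct members of a crossing family
have no common endpoint. -/
theorem IsCrossingFamily.eq_of_common_endpoint {S : Finset (ℝ × ℝ)}
    {F : Finset ((ℝ × ℝ) × (ℝ × ℝ))} (hF : IsCrossingFamily S F)
    (hS : ∀ p ∈ S, ∀ q ∈ S, ∀ r ∈ S, p ≠ q → p ≠ r → q ≠ r → orient p q r ≠ 0)
    {e f : (ℝ × ℝ) × (ℝ × ℝ)} (he : e ∈ F) (hf : f ∈ F) {p : ℝ × ℝ}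
    (hpe : p = e.1 ∨ p = e.2) (hpf : p = f.1 ∨ p = f.2) : e = f := by
  by_contra hne
  have key : ∀ q r : ℝ × ℝ, q ∈ S → r ∈ S → p ∈ S → p ≠ q → p ≠ r → ¬ Crosses p q p r := by
    intro q r hq hr hp hpq hpr hc
    rcases eq_or_ne q r with rfl | hqr
    · exact not_crosses_self hpq hc
    · obtain ⟨a, b, _, hb, h⟩ := hc.exists_orient_add_eq_zero
      have h0 : orient p q p = 0 := by simp [orient]
      rw [h0, mul_zero, zero_add] at h
      exact hS p hp q hq r hr hpq hpr hqr ((mul_eq_zero.1 h).resolve_left hb.ne')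
  obtain ⟨he1, he2, he3⟩ := hF.1 e he
  obtain ⟨hf1, hf2, hf3⟩ := hF.1 f hf
  have hc := hF.2 e he f hf hne
  rcases hpe with rfl | rfl <;> rcases hpf with hpf | hpf
  · exact key _ _ he2 hf2 he1 he3 (hpf ▸ hf3) (by rw [← hpf] at hc; exact hc)
  · exact key _ _ he2 hf1 he1 he3 (hpf ▸ hf3.symm) (by rw [← hpf] at hc; exact hc.swap_right)
  · exact key _ _ he1 hf2 he2 he3.symm (hpf ▸ hf3) (by rw [← hpf] at hc; exact hc.swap_left)
  · exact key _ _ he1 hf1 he2 he3.symm (hpf ▸ hf3.symm)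
      (by rw [← hpf] at hc; exact hc.swap_left.swap_right)

/-- A form of König's theorem: a finite bipartite graph has a matching with `k` edges or a
vertex cover with fewer than `k` vertices. -/
theorem exists_matching_or_cover {α β : Type*} [Fintype α] [Fintype β] [Nonempty β]
    (R : α → β → Prop) (k : ℕ) (hk : k ≤ Fintype.card α) :
    (∃ (s : Finset α) (g : α → β), k ≤ s.card ∧ Set.InjOn g s ∧ ∀ a ∈ s, R a (g a)) ∨
      ∃ (A : Finset α) (B : Finset β), A.card + B.card < k ∧ ∀ a b, R a b → a ∈ A ∨ b ∈ B := by
  classical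
  let N : α → Finset β := fun a => Finset.univ.filter (R a)
  let t : α → Finset (β ⊕ Fin (Fintype.card α - k)) := fun a => (N a).disjSum Finset.univ
  by_cases hall : ∀ s : Finset α, s.card ≤ (s.biUnion t).card
  · left
    obtain ⟨f, hf, hft⟩ := (Finset.all_card_le_biUnion_card_iff_exists_injective t).1 hall
    have hleft : ∀ a ∈ Finset.univ.filter (fun a => (f a).isLeft), ∃ b, f a = Sum.inl b := by
      intro a ha
      exact Sum.isLeft_iff.1 (Finset.mem_filter.1 ha).2
    choose! g hg using hleft
    refine ⟨Finset.univ.filter (fun a => (f a).isLeft), g, ?_, ?_, ?_⟩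
    · have hr : (Finset.univ.filter (fun a => ¬ (f a).isLeft)).card ≤ Fintype.card α - k := by
        have := Finset.card_le_card_of_injOn
          (s := Finset.univ.filter (fun a => ¬ (f a).isLeft))
          (t := (Finset.univ : Finset (Fin (Fintype.card α - k))).map Function.Embedding.inr)
          f ?_ hf.injOn
        · simpa using this
        · intro a ha
          have h2 := (Finset.mem_filter.1 ha).2
          rcases h : f a with b | c
          · simp [h] at h2
          · simp
      have := Finset.card_filter_add_card_filter_not (s := (Finset.univ : Finset α))
        (fun a => ((f a).isLeft : Prop))
      rw [Finset.card_univ] at this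
      omega
    · intro a ha b hb hab
      exact hf (by rw [hg a ha, hg b hb, hab])
    · intro a ha
      have := hft a
      rw [hg a ha] at this
      simpa [t, N] using this
  · right
    push Not at hall
    obtain ⟨s, hs⟩ := hall
    refine ⟨sᶜ, s.biUnion N, ?_, ?_⟩
    · have hne : s.Nonempty := by
        rw [Finset.nonempty_iff_ne_empty]
        rintro rfl
        simp at hs
      have hsub : (s.biUnion N).disjSum Finset.univ ⊆ s.biUnion t := by
        intro x hx
        obtain ⟨a₀, ha₀⟩ := hne
        rcases x with b | c
        · simpa [t] using hx
        · simpa [t] using ⟨a₀, ha₀⟩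
      have h1 := Finset.card_le_card hsub
      rw [Finset.card_disjSum, Finset.card_univ, Fintype.card_fin] at h1
      have h2 := Finset.card_compl_add_card s
      omega
    · intro a b hab
      by_cases ha : a ∈ s
      · exact Or.inr (Finset.mem_biUnion.2 ⟨a, ha, by simpa [N] using hab⟩)
      · exact Or.inl (Finset.mem_compl.2 ha)

/-- The abscissas of nine points without three pairwise crossing segments. -/
def baseX : Fin 9 → ℤ := ![16, 15, 13, 11, 12, 3, 1, 12, 13]

/-- The ordinates of nine points without three pairwise crossing segments. -/
def baseY : Fin 9 → ℤ := ![0, 3, 5, 6, 9, 11, 12, 13, 14]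

/-- Twice the signed area of a triangle of the nine base points. -/
def baseOrient (i j l : Fin 9) : ℤ :=
  (baseX j - baseX i) * (baseY l - baseY i) - (baseY j - baseY i) * (baseX l - baseX i)

/-- The segments `ij` and `lm` between base points cross. -/
def BaseCross (i j l m : Fin 9) : Prop :=
  baseOrient i j l * baseOrient i j m < 0 ∧ baseOrient l m i * baseOrient l m j < 0

instance (i j l m : Fin 9) : Decidable (BaseCross i j l m) :=
  inferInstanceAs (Decidable (_ ∧ _))

theorem baseX_diff (i j : Fin 9) : |baseX i - baseX j| ≤ 15 := by
  revert i j; decide +kernel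

theorem baseY_diff (i j : Fin 9) : |baseY i - baseY j| ≤ 14 := by
  revert i j; decide +kernel

theorem baseY_strictMono : StrictMono baseY := by
  unfold StrictMono; decide +kernel

theorem baseOrient_ne_zero :
    ∀ i j l : Fin 9, i ≠ j → i ≠ l → j ≠ l → baseOrient i j l ≠ 0 := by
  decide +kernel

theorem not_baseCross_triple : ∀ i j : Fin 9, i < j → ∀ l m : Fin 9, l < m →
    BaseCross i j l m → ∀ p q : Fin 9, p < q → BaseCross i j p q → ¬ BaseCross l m p q := by
  decide +kernel

/-- The points of the cluster replacing the base point `i`; they lie on a flat parabola. -/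
def clusterPt (i : Fin 9) (u : ℝ) : ℝ × ℝ := (baseX i + u, baseY i + u ^ 2)

/-- The range of the parameter of a cluster. -/
def clusterRange : Set ℝ := Set.Icc 0 (1 / 200)

theorem abs_orient_clusterPt_sub_lt (i j l : Fin 9) {u v w : ℝ} (hu : u ∈ clusterRange)
    (hv : v ∈ clusterRange) (hw : w ∈ clusterRange) :
    |orient (clusterPt i u) (clusterPt j v) (clusterPt l w) - baseOrient i j l| < 1 := by
  have key : ∀ a b c d a' b' c' d' : ℝ, |a| ≤ 15 → |b| ≤ 15 → |c| ≤ 15 → |d| ≤ 15 →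
      |a'| ≤ 1 / 200 → |b'| ≤ 1 / 200 → |c'| ≤ 1 / 200 → |d'| ≤ 1 / 200 →
      |(a + a') * (b + b') - (c + c') * (d + d') - (a * b - c * d)| < 1 := by
    intro a b c d a' b' c' d' ha hb hc hd ha' hb' hc' hd'
    have m : ∀ x y r t : ℝ, |x| ≤ r → |y| ≤ t → |x * y| ≤ r * t := fun x y r t hx hy => by
      rw [abs_mul]
      exact mul_le_mul hx hy (abs_nonneg y) ((abs_nonneg x).trans hx)
    have h1 := abs_le.1 (m a b' _ _ ha hb')
    have h2 := abs_le.1 (m a' b _ _ ha' hb)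
    have h3 := abs_le.1 (m a' b' _ _ ha' hb')
    have h4 := abs_le.1 (m c d' _ _ hc hd')
    have h5 := abs_le.1 (m c' d _ _ hc' hd)
    have h6 := abs_le.1 (m c' d' _ _ hc' hd')
    rw [abs_lt]
    constructor <;> nlinarith
  have hX : ∀ i j : Fin 9, |(baseX i : ℝ) - baseX j| ≤ 15 := fun i j => by
    exact_mod_cast baseX_diff i j
  have hY : ∀ i j : Fin 9, |(baseY i : ℝ) - baseY j| ≤ 15 := fun i j => by
    exact_mod_cast (baseY_diff i j).trans (by norm_num)
  have hp : ∀ {x y : ℝ}, x ∈ clusterRange → y ∈ clusterRange → |x - y| ≤ 1 / 200 := by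
    intro x y hx hy
    rw [abs_le]
    constructor <;> linarith [hx.1, hx.2, hy.1, hy.2]
  have hsq : ∀ {x : ℝ}, x ∈ clusterRange → x ^ 2 ∈ clusterRange := fun {x} hx =>
    ⟨sq_nonneg x, by nlinarith [hx.1, hx.2]⟩
  have := key (baseX j - baseX i) (baseY l - baseY i) (baseY j - baseY i) (baseX l - baseX i)
    (v - u) (w ^ 2 - u ^ 2) (v ^ 2 - u ^ 2) (w - u) (hX _ _) (hY _ _) (hY _ _) (hX _ _)
    (hp hv hu) (hp (hsq hw) (hsq hu)) (hp (hsq hv) (hsq hu)) (hp hw hu)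
  convert this using 2
  simp only [orient, clusterPt, baseOrient]
  push_cast
  ring

theorem orient_clusterPt_pos {i j l : Fin 9} (h : 0 < baseOrient i j l) {u v w : ℝ}
    (hu : u ∈ clusterRange) (hv : v ∈ clusterRange) (hw : w ∈ clusterRange) :
    0 < orient (clusterPt i u) (clusterPt j v) (clusterPt l w) := by
  have h1 := (abs_lt.1 (abs_orient_clusterPt_sub_lt i j l hu hv hw)).1
  have h2 : (1 : ℝ) ≤ baseOrient i j l := by exact_mod_cast h
  linarith

theorem orient_clusterPt_neg {i j l : Fin 9} (h : baseOrient i j l < 0) {u v w : ℝ}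
    (hu : u ∈ clusterRange) (hv : v ∈ clusterRange) (hw : w ∈ clusterRange) :
    orient (clusterPt i u) (clusterPt j v) (clusterPt l w) < 0 := by
  have h1 := (abs_lt.1 (abs_orient_clusterPt_sub_lt i j l hu hv hw)).2
  have h2 : (baseOrient i j l : ℝ) ≤ -1 := by exact_mod_cast Int.le_sub_one_of_lt h
  linarith

/-- The line through two points of a cluster passes below the higher clusters and above the
lower ones. -/
theorem exists_orient_clusterPt_self (i l : Fin 9) {u v w : ℝ} (hu : u ∈ clusterRange)
    (hv : v ∈ clusterRange) (hw : w ∈ clusterRange) :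
    ∃ c : ℝ, orient (clusterPt i u) (clusterPt i v) (clusterPt l w) = (v - u) * c ∧
      (i < l → 0 < c) ∧ (l < i → c < 0) := by
  refine ⟨(baseY l - baseY i) + (w ^ 2 - u ^ 2) - (v + u) * (baseX l - baseX i + (w - u)),
    by simp only [orient, clusterPt]; ring, ?_⟩
  obtain ⟨hu0, hu1⟩ := hu
  obtain ⟨hv0, hv1⟩ := hv
  obtain ⟨hw0, hw1⟩ := hw
  have hX : |(baseX l : ℝ) - baseX i| ≤ 15 := by exact_mod_cast baseX_diff l i
  obtain ⟨hX0, hX1⟩ := abs_le.1 hX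
  have h1 : (v + u) * (baseX l - baseX i + (w - u)) ≤ 1 / 100 * 16 :=
    (mul_le_mul_of_nonneg_left (by linarith : (baseX l - baseX i + (w - u) : ℝ) ≤ 16)
      (by linarith)).trans (by nlinarith)
  have h2 : -(1 / 100 * 16) ≤ (v + u) * (baseX l - baseX i + (w - u)) :=
    le_trans (by nlinarith) (mul_le_mul_of_nonneg_left
      (by linarith : (-16 : ℝ) ≤ (baseX l - baseX i + (w - u) : ℝ)) (by linarith : 0 ≤ v + u))
  constructor
  · intro h
    have : (baseY i : ℝ) + 1 ≤ baseY l := by exact_mod_cast baseY_strictMono h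
    nlinarith
  · intro h
    have : (baseY l : ℝ) + 1 ≤ baseY i := by exact_mod_cast baseY_strictMono h
    nlinarith

theorem clusterPt_inj {i j : Fin 9} {u v : ℝ} (hu : u ∈ clusterRange) (hv : v ∈ clusterRange)
    (h : clusterPt i u = clusterPt j v) : i = j ∧ u = v := by
  obtain ⟨h1, h2⟩ := Prod.ext_iff.1 h
  simp only [clusterPt] at h1 h2
  obtain ⟨hu0, hu1⟩ := hu
  obtain ⟨hv0, hv1⟩ := hv
  have hij : i = j := by
    rcases lt_trichotomy i j with hlt | heq | hlt
    · have : (baseY i : ℝ) + 1 ≤ baseY j := by exact_mod_cast baseY_strictMono hlt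
      nlinarith
    · exact heq
    · have : (baseY j : ℝ) + 1 ≤ baseY i := by exact_mod_cast baseY_strictMono hlt
      nlinarith
  subst hij
  exact ⟨rfl, by linarith⟩

theorem orient_clusterPt_ne_zero {i j l : Fin 9} {u v w : ℝ}
    (hu : u ∈ clusterRange) (hv : v ∈ clusterRange) (hw : w ∈ clusterRange)
    (h1 : clusterPt i u ≠ clusterPt j v) (h2 : clusterPt i u ≠ clusterPt l w)
    (h3 : clusterPt j v ≠ clusterPt l w) :
    orient (clusterPt i u) (clusterPt j v) (clusterPt l w) ≠ 0 := by
  have same : ∀ {i l : Fin 9} {u v w : ℝ}, u ∈ clusterRange → v ∈ clusterRange →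
      w ∈ clusterRange → clusterPt i u ≠ clusterPt i v → i ≠ l →
      orient (clusterPt i u) (clusterPt i v) (clusterPt l w) ≠ 0 := by
    intro i l u v w hu hv hw huv hil
    obtain ⟨c, hc, hlt, hgt⟩ := exists_orient_clusterPt_self i l hu hv hw
    rw [hc]
    refine mul_ne_zero (sub_ne_zero.2 fun h => huv (h ▸ rfl)) ?_
    rcases lt_or_gt_of_ne hil with h | h
    · exact (hlt h).ne'
    · exact (hgt h).ne
  have rot : ∀ p q r : ℝ × ℝ, orient p q r = orient q r p := fun p q r => by
    simp only [orient]; ring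
  by_cases hij : i = j
  · subst hij
    by_cases hil : i = l
    · subst hil
      have : orient (clusterPt i u) (clusterPt i v) (clusterPt i w) =
          (v - u) * (w - u) * (w - v) := by
        simp only [orient, clusterPt]; ring
      rw [this]
      exact mul_ne_zero (mul_ne_zero (sub_ne_zero.2 fun h => h1 (h ▸ rfl))
        (sub_ne_zero.2 fun h => h2 (h ▸ rfl))) (sub_ne_zero.2 fun h => h3 (h ▸ rfl))
    · exact same hu hv hw h1 hil
  · by_cases hil : i = l
    · subst hil
      rw [rot, rot]
      exact same hw hu hv h2.symm hij
    · by_cases hjl : j = l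
      · subst hjl
        rw [rot]
        exact same hv hw hu h3 (Ne.symm hij)
      · rcases lt_or_gt_of_ne (baseOrient_ne_zero i j l hij hil hjl) with h | h
        · exact (orient_clusterPt_neg h hu hv hw).ne
        · exact (orient_clusterPt_pos h hu hv hw).ne'

/-- Segments joining four different clusters cross only if the corresponding segments between
base points do. -/
theorem baseCross_of_crosses {i j l m : Fin 9} {u v w z : ℝ} (hu : u ∈ clusterRange)
    (hv : v ∈ clusterRange) (hw : w ∈ clusterRange) (hz : z ∈ clusterRange)
    (hij : i ≠ j) (hil : i ≠ l) (him : i ≠ m) (hjl : j ≠ l) (hjm : j ≠ m) (hlm : l ≠ m)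
    (h : Crosses (clusterPt i u) (clusterPt j v) (clusterPt l w) (clusterPt m z)) :
    BaseCross i j l m := by
  have half : ∀ {i j l m : Fin 9} {u v w z : ℝ}, u ∈ clusterRange → v ∈ clusterRange →
      w ∈ clusterRange → z ∈ clusterRange → i ≠ j → i ≠ l → i ≠ m → j ≠ l → j ≠ m →
      Crosses (clusterPt i u) (clusterPt j v) (clusterPt l w) (clusterPt m z) →
      baseOrient i j l * baseOrient i j m < 0 := by
    intro i j l m u v w z hu hv hw hz hij hil him hjl hjm h
    obtain ⟨a, b, ha, hb, hab⟩ := h.exists_orient_add_eq_zero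
    rcases lt_or_gt_of_ne (baseOrient_ne_zero i j l hij hil hjl) with h1 | h1 <;>
      rcases lt_or_gt_of_ne (baseOrient_ne_zero i j m hij him hjm) with h2 | h2
    · have := mul_neg_of_pos_of_neg ha (orient_clusterPt_neg h1 hu hv hw)
      have := mul_neg_of_pos_of_neg hb (orient_clusterPt_neg h2 hu hv hz)
      linarith
    · exact mul_neg_of_neg_of_pos h1 h2
    · exact mul_neg_of_pos_of_neg h1 h2
    · have := mul_pos ha (orient_clusterPt_pos h1 hu hv hw)
      have := mul_pos hb (orient_clusterPt_pos h2 hu hv hz)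
      linarith
  exact ⟨half hu hv hw hz hij hil him hjl hjm h,
    half hw hz hu hv hlm hil.symm hjl.symm him.symm hjm.symm h.symm⟩

/-- A segment inside the cluster `i` crosses no segment avoiding that cluster. -/
theorem not_crosses_of_cluster {i j l : Fin 9} {u v w z : ℝ} (hu : u ∈ clusterRange)
    (hv : v ∈ clusterRange) (hw : w ∈ clusterRange) (hz : z ∈ clusterRange)
    (huv : u ≠ v) (hij : i ≠ j) (hil : i ≠ l) :
    ¬ Crosses (clusterPt i u) (clusterPt i v) (clusterPt j w) (clusterPt l z) := by
  intro h
  by_cases hjl : j = l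
  · subst hjl
    obtain ⟨a, b, ha, hb, hab⟩ := h.exists_orient_add_eq_zero
    obtain ⟨c, hc, hc1, hc2⟩ := exists_orient_clusterPt_self i j hu hv hw
    obtain ⟨d, hd, hd1, hd2⟩ := exists_orient_clusterPt_self i j hu hv hz
    rw [hc, hd] at hab
    have h0 : (v - u) * (a * c + b * d) = 0 := by linarith
    have h1 := (mul_eq_zero.1 h0).resolve_left (sub_ne_zero.2 huv.symm)
    rcases lt_or_gt_of_ne hij with h2 | h2
    · have := mul_pos ha (hc1 h2)
      have := mul_pos hb (hd1 h2)
      linarith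
    · have := mul_neg_of_pos_of_neg ha (hc2 h2)
      have := mul_neg_of_pos_of_neg hb (hd2 h2)
      linarith
  · obtain ⟨a, b, ha, hb, hab⟩ := h.symm.exists_orient_add_eq_zero
    rcases lt_or_gt_of_ne (baseOrient_ne_zero j l i hjl hij.symm hil.symm) with h1 | h1
    · have := mul_neg_of_pos_of_neg ha (orient_clusterPt_neg h1 hw hz hu)
      have := mul_neg_of_pos_of_neg hb (orient_clusterPt_neg h1 hw hz hv)
      linarith
    · have := mul_pos ha (orient_clusterPt_pos h1 hw hz hu)
      have := mul_pos hb (orient_clusterPt_pos h1 hw hz hv)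
      linarith

/-- A segment going up from a cluster does not cross a segment going down from it. -/
theorem not_crosses_of_lt_of_lt {i j l : Fin 9} {u v w z : ℝ} (hu : u ∈ clusterRange)
    (hv : v ∈ clusterRange) (hw : w ∈ clusterRange) (hz : z ∈ clusterRange)
    (huv : u ≠ v) (hij : i < j) (hjl : j < l) :
    ¬ Crosses (clusterPt j u) (clusterPt i w) (clusterPt j v) (clusterPt l z) := by
  intro h
  obtain ⟨a, b, ha, hb, hab⟩ := h.exists_orient_eq
  obtain ⟨c, hc, -, hc2⟩ := exists_orient_clusterPt_self j i hu hv hw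
  obtain ⟨d, hd, hd1, -⟩ := exists_orient_clusterPt_self j l hu hv hz
  rw [hc, hd] at hab
  have h0 : (v - u) * (a * c - b * d) = 0 := by linarith
  have h1 := (mul_eq_zero.1 h0).resolve_left (sub_ne_zero.2 huv.symm)
  have := mul_neg_of_pos_of_neg ha (hc2 hij)
  have := mul_pos hb (hd1 hjl)
  linarith

/-- The union of the nine clusters with parameters in `U`. -/
noncomputable def clusterSet (U : Finset ℝ) : Finset (ℝ × ℝ) :=
  (Finset.univ ×ˢ U).image fun x : Fin 9 × ℝ => clusterPt x.1 x.2

theorem mem_clusterSet {U : Finset ℝ} {p : ℝ × ℝ} :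
    p ∈ clusterSet U ↔ ∃ i, ∃ u ∈ U, clusterPt i u = p := by
  simp [clusterSet]

theorem card_clusterSet {U : Finset ℝ} (hU : ↑U ⊆ clusterRange) :
    (clusterSet U).card = 9 * U.card := by
  rw [clusterSet, Finset.card_image_of_injOn, Finset.card_product, Finset.card_univ,
    Fintype.card_fin]
  rintro ⟨i, u⟩ hu ⟨j, v⟩ hv h
  simp only [Finset.coe_product, Set.mem_prod, Finset.mem_coe] at hu hv
  obtain ⟨rfl, rfl⟩ := clusterPt_inj (hU hu.2) (hU hv.2) h
  rfl

theorem orient_ne_zero_of_mem_clusterSet {U : Finset ℝ} (hU : ↑U ⊆ clusterRange) :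
    ∀ p ∈ clusterSet U, ∀ q ∈ clusterSet U, ∀ r ∈ clusterSet U,
      p ≠ q → p ≠ r → q ≠ r → orient p q r ≠ 0 := by
  intro p hp q hq r hr
  obtain ⟨i, u, hu, rfl⟩ := mem_clusterSet.1 hp
  obtain ⟨j, v, hv, rfl⟩ := mem_clusterSet.1 hq
  obtain ⟨l, w, hw, rfl⟩ := mem_clusterSet.1 hr
  exact orient_clusterPt_ne_zero (hU hu) (hU hv) (hU hw)

theorem genPos_clusterSet {U : Finset ℝ} (hU : ↑U ⊆ clusterRange) : GenPos (clusterSet U) :=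
  fun p hp q hq r hr hpq hpr hqr h =>
    orient_ne_zero_of_mem_clusterSet hU p hp q hq r hr hpq hpr hqr (orient_eq_zero_of_collinear h)

/-- If every segment of a crossing family has an endpoint in one of the clusters in `C`, then
the family has at most as many segments as these clusters have points. -/
theorem IsCrossingFamily.card_le_of_cover {U : Finset ℝ} (hU : ↑U ⊆ clusterRange)
    {F : Finset ((ℝ × ℝ) × (ℝ × ℝ))} (hF : IsCrossingFamily (clusterSet U) F)
    (C : Finset (Fin 9))
    (hC : ∀ e ∈ F, ∃ x : Fin 9 × ℝ, x ∈ C ×ˢ U ∧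
      (clusterPt x.1 x.2 = e.1 ∨ clusterPt x.1 x.2 = e.2)) :
    F.card ≤ C.card * U.card := by
  choose! g hg using hC
  rw [← Finset.card_product]
  refine Finset.card_le_card_of_injOn g (fun e he => (hg e he).1) ?_
  intro e he f hf hef
  refine hF.eq_of_common_endpoint (orient_ne_zero_of_mem_clusterSet hU) he hf (hg e he).2 ?_
  rw [hef]
  exact (hg f hf).2

theorem IsCrossingFamily.card_le {U : Finset ℝ} (hU : ↑U ⊆ clusterRange)
    {F : Finset ((ℝ × ℝ) × (ℝ × ℝ))} (hF : IsCrossingFamily (clusterSet U) F) :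
    F.card ≤ 2 * U.card := by
  have hrepr : ∀ e ∈ F, ∃ i j, ∃ u ∈ U, ∃ v ∈ U, e = (clusterPt i u, clusterPt j v) := by
    intro e he
    obtain ⟨h1, h2, -⟩ := hF.1 e he
    obtain ⟨i, u, hu, h1⟩ := mem_clusterSet.1 h1
    obtain ⟨j, v, hv, h2⟩ := mem_clusterSet.1 h2
    exact ⟨i, j, u, hu, v, hv, Prod.ext h1.symm h2.symm⟩
  by_cases hloop : ∃ i, ∃ u ∈ U, ∃ v ∈ U, (clusterPt i u, clusterPt i v) ∈ F
  · obtain ⟨i, u, hu, v, hv, he⟩ := hloop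
    have huv : u ≠ v := fun h => (hF.1 _ he).2.2 (h ▸ rfl)
    have := hF.card_le_of_cover hU {i} ?_
    · rw [Finset.card_singleton] at this
      omega
    intro f hf
    obtain ⟨j, l, w, hw, z, hz, rfl⟩ := hrepr f hf
    by_cases hij : i = j
    · exact ⟨(j, w), by simp [hij, hw], Or.inl rfl⟩
    by_cases hil : i = l
    · exact ⟨(l, z), by simp [hil, hz], Or.inr rfl⟩
    refine (not_crosses_of_cluster (hU hu) (hU hv) (hU hw) (hU hz) huv hij hil
      (hF.2 _ he _ hf fun h => hij ?_)).elim
    exact (clusterPt_inj (hU hu) (hU hw) (Prod.ext_iff.1 h).1).1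
  · let R : Fin 9 → Fin 9 → Prop := fun i j =>
      i < j ∧ ∃ u ∈ U, ∃ v ∈ U, Joins F (clusterPt i u) (clusterPt j v)
    have hpath : ∀ i j l, R i j → ¬ R j l := by
      rintro i j l ⟨hij, u, hu, v, hv, h⟩ ⟨hjl, w, hw, z, hz, h'⟩
      have hvw : v ≠ w := by
        rintro rfl
        have hil := (hij.trans hjl).ne
        have hi : clusterPt i u ≠ clusterPt l z :=
          fun h => hil (clusterPt_inj (hU hu) (hU hz) h).1
        have hj : clusterPt i u ≠ clusterPt j v :=
          fun h => hij.ne (clusterPt_inj (hU hu) (hU hv) h).1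
        have heq : ∀ e ∈ F, ∀ f ∈ F, (clusterPt j v = e.1 ∨ clusterPt j v = e.2) →
            (clusterPt j v = f.1 ∨ clusterPt j v = f.2) → e = f := fun e he f hf =>
          hF.eq_of_common_endpoint (orient_ne_zero_of_mem_clusterSet hU) he hf
        rcases h with h | h <;> rcases h' with h' | h' <;>
          simpa [hi, hj, Ne.symm hi, Ne.symm hj] using heq _ h _ h' (by simp) (by simp)
      have hne : clusterPt j v ≠ clusterPt j w :=
        fun h => hvw (clusterPt_inj (hU hv) (hU hw) h).2
      have hne' : clusterPt j v ≠ clusterPt l z :=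
        fun h => hjl.ne (clusterPt_inj (hU hv) (hU hz) h).1
      exact not_crosses_of_lt_of_lt (hU hv) (hU hw) (hU hu) (hU hz) hvw hij hjl
        (hF.crosses h.symm h' hne hne')
    have hcross : ∀ i j l m, R i j → R l m → i ≠ l → j ≠ m → BaseCross i j l m := by
      intro i j l m h h' hil hjm
      have him : i ≠ m := by rintro rfl; exact hpath _ _ _ h' h
      have hjl : j ≠ l := by rintro rfl; exact hpath _ _ _ h h'
      obtain ⟨hij, u, hu, v, hv, h⟩ := h
      obtain ⟨hlm, w, hw, z, hz, h'⟩ := h'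
      exact baseCross_of_crosses (hU hu) (hU hv) (hU hw) (hU hz) hij.ne hil him hjl hjm hlm.ne
        (hF.crosses h h' (fun h => hil (clusterPt_inj (hU hu) (hU hw) h).1)
          (fun h => him (clusterPt_inj (hU hu) (hU hz) h).1))
    rcases exists_matching_or_cover R 3 (by simp) with ⟨s, g, hs, hg, hR⟩ | ⟨A, B, hAB, hR⟩
    · obtain ⟨a, ha, b, hb, c, hc, hab, hac, hbc⟩ := Finset.two_lt_card.1 hs
      have key : ∀ {x y}, x ∈ s → y ∈ s → x ≠ y → BaseCross x (g x) y (g y) :=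
        fun {x y} hx hy hxy => hcross _ _ _ _ (hR x hx) (hR y hy) hxy (hg.ne hx hy hxy)
      exact (not_baseCross_triple a (g a) (hR a ha).1 b (g b) (hR b hb).1 (key ha hb hab)
        c (g c) (hR c hc).1 (key ha hc hac) (key hb hc hbc)).elim
    · have hcard := (hF.card_le_of_cover hU (A ∪ B) ?_).trans
        (Nat.mul_le_mul_right _ (Finset.card_union_le A B))
      · exact hcard.trans (Nat.mul_le_mul_right _ (by omega))
      intro e he
      obtain ⟨i, j, u, hu, v, hv, rfl⟩ := hrepr e he
      have hij : i ≠ j := by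
        rintro rfl
        exact hloop ⟨i, u, hu, v, hv, he⟩
      have hmem : i ∈ A ∪ B ∨ j ∈ A ∪ B := by
        simp only [Finset.mem_union]
        rcases lt_or_gt_of_ne hij with h | h
        · rcases hR i j ⟨h, u, hu, v, hv, Or.inl he⟩ with h | h <;> simp [h]
        · rcases hR j i ⟨h, v, hv, u, hu, Or.inr he⟩ with h | h <;> simp [h]
      rcases hmem with h | h
      · exact ⟨(i, u), Finset.mem_product.2 ⟨h, hu⟩, Or.inl rfl⟩
      · exact ⟨(j, v), Finset.mem_product.2 ⟨h, hv⟩, Or.inr rfl⟩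

theorem cf_le_of_forall {S : Finset (ℝ × ℝ)} {b : ℕ}
    (h : ∀ F, IsCrossingFamily S F → F.card ≤ b) : cf S ≤ b := by
  refine csSup_le ⟨0, ∅, by simp [IsCrossingFamily], rfl⟩ ?_
  rintro k ⟨F, hF, rfl⟩
  exact h F hF

theorem exists_genPos_cf_le (n : ℕ) :
    ∃ S : Finset (ℝ × ℝ), S.card = n ∧ GenPos S ∧ cf S ≤ 2 * (n ⌈/⌉ 9) := by
  have hinf : clusterRange.Infinite := Set.Icc_infinite (by norm_num)
  obtain ⟨U, hU, hcard⟩ := hinf.exists_subset_card_eq (n ⌈/⌉ 9)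
  have hn : n ≤ (clusterSet U).card := by
    rw [card_clusterSet hU, hcard, Nat.ceilDiv_eq_add_pred_div]
    omega
  obtain ⟨S, hS, hSn⟩ := Finset.exists_subset_card_eq hn
  refine ⟨S, hSn, (genPos_clusterSet hU).mono hS, cf_le_of_forall fun F hF => ?_⟩
  rw [← hcard]
  exact (hF.mono hS).card_le hU

/-- For every positive integer `n`, `cf(n) ≤ 2 * ⌈n / 9⌉`: there exists a set
of `n` points in the plane in general position whose largest crossing family
has size at most `2 * ⌈n / 9⌉`. -/
theorem cfNat_le_2_mul_ceilDiv_9 (n : ℕ) (hn : 0 < n) :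
    cfNat n ≤ 2 * (n ⌈/⌉ 9) ∧
    ∃ S : Finset (ℝ × ℝ), S.card = n ∧ GenPos S ∧ cf S ≤ 2 * (n ⌈/⌉ 9) := by
  obtain ⟨S, hS, hgen, hcf⟩ := exists_genPos_cf_le n
  have hle : cfNat n ≤ cf S := Nat.sInf_le ⟨S, hS, hgen, rfl⟩
  exact ⟨hle.trans hcf, S, hS, hgen, hcf⟩
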